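/- arXiv:1005.4322 — 3 statements merged into one kernel-verified Lean document; each statement's English description precedes it below -/
import Mathlib

section
/- Let d ≥ 3 be an integer and λ a real number. The function φ^(λ) satisfies: (i) φ^(λ)(0) = 1; (ii) λ·φ^(λ)(0) = d·φ^(λ)(1); and (iii) for every integer k ≥ 1, λ·φ^(λ)(k) = φ^(λ)(k−1) + (d−1)·φ^(λ)(k+1). -/
noncomputable def phi (d : ℕ) (lam : ℝ) (k : ℕ) : ℝ :=
  ((d : ℝ) - 1) ^ (-(k : ℝ) / 2) *
    (((d : ℝ) - 1) / d *
        (Polynomial.Chebyshev.U ℝ (k : ℤ)).eval (lam / (2 * Real.sqrt ((d : ℝ) - 1)))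
      - 1 / d *
        (Polynomial.Chebyshev.U ℝ ((k : ℤ) - 2)).eval (lam / (2 * Real.sqrt ((d : ℝ) - 1))))

open Polynomial.Chebyshev in
theorem eval_U_add_two (n : ℤ) (x : ℝ) :
    (U ℝ (n + 2)).eval x = 2 * x * (U ℝ (n + 1)).eval x - (U ℝ n).eval x := by
  simp [U_add_two]

theorem rpow_neg_natCast_div_two {a : ℝ} (ha : 0 ≤ a) (k : ℕ) :
    a ^ (-(k : ℝ) / 2) = (Real.sqrt a)⁻¹ ^ k := by
  rw [Real.sqrt_eq_rpow, ← Real.rpow_neg ha, ← Real.rpow_natCast, ← Real.rpow_mul ha]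
  congr 1
  ring

theorem stmt_0 (d : ℕ) (hd : 3 ≤ d) (lam : ℝ) :
    phi d lam 0 = 1 ∧
    lam * phi d lam 0 = d * phi d lam 1 ∧
    ∀ k : ℕ, 1 ≤ k →
      lam * phi d lam k = phi d lam (k - 1) + ((d : ℝ) - 1) * phi d lam (k + 1) := by
  have hd' : (3 : ℝ) ≤ d := by exact_mod_cast hd
  have hd0 : (d : ℝ) ≠ 0 := by positivity
  have ha : (0 : ℝ) < d - 1 := by linarith
  have hs : 0 < Real.sqrt ((d : ℝ) - 1) := Real.sqrt_pos.2 ha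
  have hss : Real.sqrt ((d : ℝ) - 1) ^ 2 = d - 1 := Real.sq_sqrt ha.le
  simp only [phi, rpow_neg_natCast_div_two ha.le]
  generalize Real.sqrt ((d : ℝ) - 1) = s at hs hss ⊢
  obtain ⟨x, rfl⟩ : ∃ x, lam = 2 * s * x := ⟨lam / (2 * s), by field_simp⟩
  have hx : 2 * s * x / (2 * s) = x := by field_simp
  simp only [hx, ← hss]
  have phi_zero : (s⁻¹ ^ 0 * (s ^ 2 / d * (Polynomial.Chebyshev.U ℝ ((0 : ℕ) : ℤ)).eval x -
      1 / d * (Polynomial.Chebyshev.U ℝ (((0 : ℕ) : ℤ) - 2)).eval x)) = 1 := by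
    simp only [Nat.cast_zero, zero_sub, Polynomial.Chebyshev.U_zero,
      Polynomial.Chebyshev.U_neg_two, Polynomial.eval_one, Polynomial.eval_neg, hss]
    field_simp
    ring
  refine ⟨phi_zero, ?_, ?_⟩
  · rw [phi_zero]
    norm_num [Polynomial.Chebyshev.U_one, Polynomial.Chebyshev.U_neg_one]
    field_simp
  · intro k hk
    obtain ⟨n, rfl⟩ := Nat.exists_eq_add_of_le' hk
    have h₁ := eval_U_add_two (n : ℤ) x
    have h₂ := eval_U_add_two ((n : ℤ) - 2) x
    rw [show (n : ℤ) - 2 + 2 = n by ring, show (n : ℤ) - 2 + 1 = n - 1 by ring] at h₂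
    rw [Nat.add_sub_cancel]
    push_cast
    rw [show (n : ℤ) + 1 - 2 = n - 1 by ring, show (n : ℤ) + 1 + 1 = n + 2 by ring,
      show (n : ℤ) + 2 - 2 = n by ring, h₁, h₂, pow_succ _ (n + 1), pow_succ _ n]
    generalize s⁻¹ ^ n = c
    field_simp
    ring
end

section
/- Let d ≥ 3 be an integer and λ a real number with |λ| ≤ 2√(d−1). Then for every integer k ≥ 0, |φ^(λ)(k)| ≤ (k+1)·(d−1)^(−k/2). In particular φ^(λ)(k) decays exponentially in k. -/
open Polynomial.Chebyshev in
theorem abs_eval_U_real_le {x : ℝ} (hx : |x| ≤ 1) (n : ℕ) :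
    |(U ℝ (n : ℤ)).eval x| ≤ n + 1 := by
  induction n with
  | zero => simp
  | succ n ih =>
    have hT : |(T ℝ ((n : ℤ) + 1)).eval x| ≤ 1 := abs_eval_T_real_le_one _ hx
    rw [Nat.cast_succ, U_eq_X_mul_U_add_T, Polynomial.eval_add, Polynomial.eval_mul,
      Polynomial.eval_X]
    have hxU : |x * (U ℝ (n : ℤ)).eval x| ≤ n + 1 := by
      rw [abs_mul]
      exact (mul_le_of_le_one_left (abs_nonneg _) hx).trans ih
    push_cast
    linarith [abs_add_le (x * (U ℝ (n : ℤ)).eval x) ((T ℝ ((n : ℤ) + 1)).eval x)]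

open Polynomial.Chebyshev in
theorem abs_eval_U_real_sub_two_le {x : ℝ} (hx : |x| ≤ 1) (n : ℕ) :
    |(U ℝ ((n : ℤ) - 2)).eval x| ≤ n + 1 := by
  match n with
  | 0 => simp
  | 1 => norm_num
  | m + 2 =>
    have h := abs_eval_U_real_le hx m
    rw [show ((m + 2 : ℕ) : ℤ) - 2 = m by push_cast; ring]
    push_cast
    linarith

theorem stmt_2 (d : ℕ) (hd : 3 ≤ d) (lam : ℝ)
    (hlam : |lam| ≤ 2 * Real.sqrt ((d : ℝ) - 1)) :
    ∀ k : ℕ, |phi d lam k| ≤ ((k : ℝ) + 1) * ((d : ℝ) - 1) ^ (-(k : ℝ) / 2) := by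
  intro k
  have hd' : (3 : ℝ) ≤ d := by exact_mod_cast hd
  have hd1 : (0 : ℝ) ≤ (d : ℝ) - 1 := by linarith
  have hx : |lam / (2 * Real.sqrt ((d : ℝ) - 1))| ≤ 1 := by
    rw [abs_div, abs_of_nonneg (by positivity : 0 ≤ 2 * Real.sqrt ((d : ℝ) - 1))]
    exact div_le_one_of_le₀ hlam (by positivity)
  have ha : 0 ≤ ((d : ℝ) - 1) / d := by positivity
  have hb : 0 ≤ 1 / (d : ℝ) := by positivity
  rw [phi, abs_mul, abs_of_nonneg (Real.rpow_nonneg hd1 _), mul_comm]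
  gcongr
  refine (abs_sub _ _).trans ?_
  rw [abs_mul, abs_mul, abs_of_nonneg ha, abs_of_nonneg hb]
  calc _ ≤ ((d : ℝ) - 1) / d * (k + 1) + 1 / d * (k + 1) := by
        gcongr
        · exact abs_eval_U_real_le hx k
        · exact abs_eval_U_real_sub_two_le hx k
    _ = k + 1 := by field_simp; ring
end

section
/- Let d ≥ 3 be an integer and λ a real number with |λ| ≤ 2√(d−1), and let G be a d-regular tree with vertex set V. Then the kernel (u, v) ↦ φ^(λ)(dist(u,v)) is positive semidefinite on V: for every integer m ≥ 1, every family of vertices v₁, …, v_m ∈ V, and every family of reals c₁, …, c_m, one has Σ_{i=1}^m Σ_{j=1}^m c_i·c_j·φ^(λ)(dist(v_i, v_j)) ≥ 0. -/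
open ComplexConjugate in
/-- With `e + e⁻¹ = 2x` and `|e| = 1`, the recurrence `U_{k-1} = e U_{k-2} + e ē^k`. -/
theorem chebyshev_U_eq_mul_add (x : ℝ) (e : ℂ) (hsum : e + conj e = 2 * x)
    (hmul : e * conj e = 1) (k : ℕ) :
    (((Polynomial.Chebyshev.U ℝ ((k : ℤ) - 1)).eval x : ℝ) : ℂ) =
      e * ((Polynomial.Chebyshev.U ℝ ((k : ℤ) - 2)).eval x : ℝ) + e * conj e ^ k := by
  induction k with
  | zero => simp [Polynomial.Chebyshev.U_neg_two]
  | succ k ih =>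
    have h := Polynomial.Chebyshev.U_add_two ℝ ((k : ℤ) - 2)
    rw [show (k : ℤ) - 2 + 2 = k by ring, show (k : ℤ) - 2 + 1 = k - 1 by ring] at h
    rw [Nat.cast_succ, show (k : ℤ) + 1 - 1 = k by ring, show (k : ℤ) + 1 - 2 = k - 1 by ring, h]
    simp only [Polynomial.eval_sub, Polynomial.eval_mul, Polynomial.eval_ofNat, Polynomial.eval_X]
    simp only [Complex.ofReal_sub, Complex.ofReal_mul, Complex.ofReal_ofNat]
    rw [← hsum]
    linear_combination conj e * ih +
      (((Polynomial.Chebyshev.U ℝ ((k : ℤ) - 2)).eval x : ℝ) : ℂ) * hmul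

open ComplexConjugate in
theorem exists_unit_add_conj_eq {x : ℝ} (hx : |x| ≤ 1) :
    ∃ e : ℂ, e + conj e = 2 * x ∧ e * conj e = 1 := by
  refine ⟨⟨x, Real.sqrt (1 - x ^ 2)⟩, ?_, ?_⟩
  · apply Complex.ext <;> simp; ring
  · rw [Complex.mul_conj, Complex.normSq_mk, Real.mul_self_sqrt]
    · norm_cast; ring
    · have := (sq_le_one_iff_abs_le_one x).2 hx
      linarith

theorem phi_zero {d : ℕ} (hd : 3 ≤ d) (lam : ℝ) : phi d lam 0 = 1 := by
  have : (d : ℝ) ≠ 0 := by positivity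
  simp [phi, Polynomial.Chebyshev.U_neg_two]
  field_simp
  ring

open ComplexConjugate in
theorem exists_phi_succ {d : ℕ} (hd : 3 ≤ d) {lam : ℝ}
    (hlam : |lam| ≤ 2 * Real.sqrt ((d : ℝ) - 1)) :
    ∃ z : ℂ, ((d : ℂ) - 1) * (z * conj z) = 1 ∧ ∀ k : ℕ,
      (d : ℂ) * phi d lam (k + 1) =
        z * (d * phi d lam k) - z * conj z ^ k + (d - 1) * conj z ^ (k + 1) := by
  have hd3 : (3 : ℝ) ≤ d := by exact_mod_cast hd
  have hq : (0 : ℝ) < d - 1 := by linarith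
  have hdC : (d : ℂ) ≠ 0 := by norm_cast; omega
  set r := Real.sqrt ((d : ℝ) - 1) with hr
  have hr0 : 0 < r := Real.sqrt_pos.2 hq
  have hrr : r * r = d - 1 := Real.mul_self_sqrt hq.le
  have hx : |lam / (2 * r)| ≤ 1 := by
    rw [abs_div, abs_of_pos (by positivity : 0 < 2 * r)]
    exact div_le_one_of_le₀ hlam (by positivity)
  obtain ⟨e, hsum, hmul⟩ := exists_unit_add_conj_eq hx
  have hpow (k : ℕ) : ((d : ℝ) - 1) ^ (-(k : ℝ) / 2) = r⁻¹ ^ k := by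
    rw [hr, Real.sqrt_eq_rpow, ← Real.rpow_neg hq.le, ← Real.rpow_natCast,
      ← Real.rpow_mul hq.le]
    congr 1; ring
  have hphi (k : ℕ) : (d : ℂ) * phi d lam k = (r⁻¹ : ℂ) ^ k *
      ((d - 1) * ((Polynomial.Chebyshev.U ℝ (k : ℤ)).eval (lam / (2 * r)) : ℝ) -
        ((Polynomial.Chebyshev.U ℝ ((k : ℤ) - 2)).eval (lam / (2 * r)) : ℝ)) := by
    rw [phi, hpow, ← hr]
    generalize (Polynomial.Chebyshev.U ℝ (k : ℤ)).eval (lam / (2 * r)) = a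
    generalize (Polynomial.Chebyshev.U ℝ ((k : ℤ) - 2)).eval (lam / (2 * r)) = b
    push_cast
    field_simp
  have hrrC : (r : ℂ) * r = d - 1 := by exact_mod_cast hrr
  have hrC : (r : ℂ) ≠ 0 := by exact_mod_cast hr0.ne'
  refine ⟨(r : ℂ)⁻¹ * e, ?_, fun k => ?_⟩
  · rw [← hrrC, map_mul, map_inv₀, Complex.conj_ofReal]
    field_simp
    exact hmul
  · have h₁ := chebyshev_U_eq_mul_add _ e hsum hmul k
    have h₂ := chebyshev_U_eq_mul_add _ e hsum hmul (k + 2)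
    rw [show ((k + 2 : ℕ) : ℤ) - 1 = k + 1 by push_cast; ring,
      show ((k + 2 : ℕ) : ℤ) - 2 = k by push_cast; ring] at h₂
    rw [hphi, hphi, map_mul, map_inv₀, Complex.conj_ofReal, Nat.cast_succ,
      show (k : ℤ) + 1 - 2 = k - 1 by ring, h₁, h₂]
    linear_combination (r : ℂ)⁻¹ ^ (k + 1) * (d - 1) * conj e ^ (k + 1) * hmul

namespace SimpleGraph

variable {V : Type*} {G : SimpleGraph V}

theorem IsAcyclic.length_eq_dist (hG : G.IsAcyclic) {u v : V} {p : G.Walk u v} (hp : p.IsPath) :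
    p.length = G.dist u v := by
  obtain ⟨w, hw, hl⟩ := p.reachable.exists_path_of_dist
  have := hG.subsingleton_path u v
  have h : p = w := congrArg Subtype.val (Subsingleton.elim (⟨p, hp⟩ : G.Path u v) ⟨w, hw⟩)
  rw [← hl, h]

/-- Finite vertex sets obtained from a single vertex by successively attaching a neighbour. -/
inductive IsGrown (G : SimpleGraph V) : Finset V → Prop
  | singleton (a : V) : IsGrown G {a}
  | cons {T : Finset V} {x y : V} (hT : IsGrown G T) (hx : x ∈ T) (hy : y ∉ T)
      (hxy : G.Adj x y) : IsGrown G (T.cons y hy)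

theorem IsGrown.nonempty {T : Finset V} (hT : G.IsGrown T) : T.Nonempty := by
  cases hT <;> simp

theorem IsGrown.exists_isPath {T : Finset V} (hT : G.IsGrown T) {u v : V} (hu : u ∈ T)
    (hv : v ∈ T) : ∃ p : G.Walk u v, p.IsPath ∧ ∀ w ∈ p.support, w ∈ T := by
  induction hT generalizing u v with
  | singleton a =>
    obtain rfl := Finset.mem_singleton.1 hu
    obtain rfl := Finset.mem_singleton.1 hv
    exact ⟨.nil, by simp⟩
  | @cons T x y hT hx hy hxy ih =>
    have key {v : V} (hv : v ∈ T) :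
        ∃ p : G.Walk y v, p.IsPath ∧ ∀ w ∈ p.support, w ∈ T.cons y hy := by
      obtain ⟨p, hp, hpT⟩ := ih hx hv
      refine ⟨.cons hxy.symm p, hp.cons fun h => hy (hpT _ h), fun w hw => ?_⟩
      rw [Walk.support_cons, List.mem_cons] at hw
      exact Finset.mem_cons.2 (hw.imp_right (hpT w))
    rcases Finset.mem_cons.1 hu with rfl | hu' <;> rcases Finset.mem_cons.1 hv with rfl | hv'
    · exact ⟨.nil, by simp⟩
    · exact key hv'
    · obtain ⟨p, hp, hpT⟩ := key hu'
      exact ⟨p.reverse, hp.reverse, by simpa using hpT⟩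
    · obtain ⟨p, hp, hpT⟩ := ih hu' hv'
      exact ⟨p, hp, fun w hw => Finset.mem_cons_of_mem (hpT w hw)⟩

theorem IsGrown.dist_eq (hG : G.IsAcyclic) {T : Finset V} (hT : G.IsGrown T) {x y t : V}
    (hx : x ∈ T) (hy : y ∉ T) (hxy : G.Adj x y) (ht : t ∈ T) :
    G.dist y t = G.dist x t + 1 := by
  obtain ⟨p, hp, hpT⟩ := hT.exists_isPath hx ht
  rw [← hG.length_eq_dist hp,
    ← hG.length_eq_dist (hp.cons (h := hxy.symm) fun h => hy (hpT _ h)), Walk.length_cons]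

theorem IsGrown.exists_superset_of_walk {T : Finset V} (hT : G.IsGrown T) {a b : V}
    (p : G.Walk a b) (ha : a ∈ T) : ∃ S, G.IsGrown S ∧ T ⊆ S ∧ b ∈ S := by
  induction p generalizing T with
  | nil => exact ⟨T, hT, subset_rfl, ha⟩
  | @cons a x b h p ih =>
    by_cases hx : x ∈ T
    · exact ih hT hx
    · obtain ⟨S, hS, hTS, hb⟩ := ih (hT.cons ha hx h) (Finset.mem_cons_self x T)
      exact ⟨S, hS, (Finset.subset_cons hx).trans hTS, hb⟩

theorem Connected.exists_isGrown (hG : G.Connected) (s : Finset V) :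
    ∃ T, G.IsGrown T ∧ s ⊆ T := by
  classical
  induction s using Finset.induction_on with
  | empty => exact ⟨{hG.nonempty.some}, .singleton _, by simp⟩
  | insert b s _ ih =>
    obtain ⟨T, hT, hs⟩ := ih
    obtain ⟨a, ha⟩ := hT.nonempty
    obtain ⟨p⟩ := hG.preconnected a b
    obtain ⟨S, hS, hTS, hb⟩ := hT.exists_superset_of_walk p ha
    exact ⟨S, hS, Finset.insert_subset hb (hs.trans hTS)⟩

open Classical in
/-- The number of neighbours of `x` outside `T`. -/
noncomputable def outDegree (G : SimpleGraph V) [G.LocallyFinite] (T : Finset V) (x : V) : ℕ :=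
  (G.neighborFinset x \ T).card

variable [G.LocallyFinite]

theorem IsGrown.sum_outDegree_cons (hG : G.IsAcyclic) {d : ℕ} (hreg : G.IsRegularOfDegree d)
    {T : Finset V} (hT : G.IsGrown T) {x y : V} (hx : x ∈ T) (hy : y ∉ T) (hxy : G.Adj x y)
    (F : V → ℂ) :
    ∑ t ∈ T.cons y hy, (G.outDegree (T.cons y hy) t : ℂ) * F t =
      ∑ t ∈ T, (G.outDegree T t : ℂ) * F t - F x + (d - 1) * F y := by
  classical
  have hadj {t : V} (ht : t ∈ T) (h : G.Adj y t) : t = x := by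
    have h₁ := hT.dist_eq hG hx hy hxy ht
    rw [dist_eq_one_iff_adj.2 h] at h₁
    obtain ⟨p, -, -⟩ := hT.exists_isPath hx ht
    exact (p.reachable.dist_eq_zero_iff.1 (by omega)).symm
  have hout_y : (G.outDegree (T.cons y hy) y : ℂ) = d - 1 := by
    have : G.neighborFinset y \ T.cons y hy = (G.neighborFinset y).erase x := by
      ext t
      simp only [Finset.mem_sdiff, mem_neighborFinset, Finset.mem_cons, Finset.mem_erase]
      constructor
      · rintro ⟨h, h'⟩
        exact ⟨fun h₂ => h' (.inr (h₂ ▸ hx)), h⟩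
      · rintro ⟨h, h'⟩
        exact ⟨h', fun h₂ => h₂.elim (fun h₃ => h'.ne h₃.symm) fun h₃ => h (hadj h₃ h')⟩
    have hmem : x ∈ G.neighborFinset y := by simpa using hxy.symm
    have := Finset.card_erase_add_one hmem
    rw [card_neighborFinset_eq_degree, hreg.degree_eq y] at this
    rw [outDegree, ‹_ \ _ = _›, ← this]
    push_cast; ring
  have hout {t : V} (ht : t ∈ T) :
      (G.outDegree (T.cons y hy) t : ℂ) = G.outDegree T t - if t = x then 1 else 0 := by
    have he : G.neighborFinset t \ T.cons y hy = (G.neighborFinset t \ T).erase y := by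
      ext w
      simp only [Finset.mem_sdiff, Finset.mem_cons, Finset.mem_erase]
      tauto
    rw [outDegree, he]
    split_ifs with htx
    · have hmem : y ∈ G.neighborFinset t \ T := by simpa [htx, hy] using hxy
      rw [outDegree, ← Finset.card_erase_add_one hmem]
      push_cast; ring
    · rw [Finset.erase_eq_of_notMem, outDegree, sub_zero]
      intro h
      rw [Finset.mem_sdiff, mem_neighborFinset] at h
      exact htx (hadj ht h.1.symm)
  rw [Finset.sum_cons, hout_y, Finset.sum_congr rfl fun t ht => by rw [hout ht, sub_mul],
    Finset.sum_sub_distrib]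
  simp only [ite_mul, one_mul, zero_mul, Finset.sum_ite_eq', hx, if_true]
  ring

open ComplexConjugate in
/-- A function of the distance satisfying the first-order recurrence with parameter `z` is
represented as a sum of rank-one kernels over the boundary of any grown set. -/
theorem IsGrown.sum_outDegree_mul_pow_dist (hG : G.IsAcyclic) {d : ℕ}
    (hreg : G.IsRegularOfDegree d) {f : ℕ → ℝ} {z : ℂ} (hz : ((d : ℂ) - 1) * (z * conj z) = 1)
    (hf₀ : f 0 = 1)
    (hf : ∀ k : ℕ, (d : ℂ) * f (k + 1) =
      z * (d * f k) - z * conj z ^ k + (d - 1) * conj z ^ (k + 1))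
    {T : Finset V} (hT : G.IsGrown T) {u v : V} (hu : u ∈ T) (hv : v ∈ T) :
    ∑ t ∈ T, (G.outDegree T t : ℂ) * (z ^ G.dist u t * conj z ^ G.dist v t) =
      d * f (G.dist u v) := by
  classical
  induction hT generalizing u v with
  | singleton a =>
    obtain rfl := Finset.mem_singleton.1 hu
    obtain rfl := Finset.mem_singleton.1 hv
    have : G.outDegree {v} v = d := by
      rw [outDegree, Finset.sdiff_singleton_eq_erase, Finset.erase_eq_of_notMem (by simp),
        card_neighborFinset_eq_degree, hreg.degree_eq v]
    simp [this, hf₀]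
  | @cons T x y hT hx hy hxy ih =>
    have hdist {t : V} (ht : t ∈ T) := hT.dist_eq hG hx hy hxy ht
    have key {v : V} (hv : v ∈ T) :
        ∑ t ∈ T.cons y hy, (G.outDegree (T.cons y hy) t : ℂ) *
          (z ^ G.dist y t * conj z ^ G.dist v t) = d * f (G.dist y v) := by
      have hsum : ∑ t ∈ T, (G.outDegree T t : ℂ) * (z ^ G.dist y t * conj z ^ G.dist v t) =
          z * (d * f (G.dist x v)) := by
        rw [← ih hx hv, Finset.mul_sum]
        refine Finset.sum_congr rfl fun t ht => ?_
        rw [hdist ht]; ring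
      rw [hT.sum_outDegree_cons hG hreg hx hy hxy, hsum, hdist hv, hf, dist_self,
        dist_comm (u := v) (v := y), hdist hv, hdist hx, dist_self,
        dist_comm (u := v) (v := x)]
      ring
    rcases Finset.mem_cons.1 hu with rfl | hu' <;> rcases Finset.mem_cons.1 hv with rfl | hv'
    · have hsum : ∑ t ∈ T, (G.outDegree T t : ℂ) * (z ^ G.dist v t * conj z ^ G.dist v t) =
          z * conj z * (d * f (G.dist x x)) := by
        rw [← ih hx hx, Finset.mul_sum]
        refine Finset.sum_congr rfl fun t ht => ?_
        rw [hdist ht]; ring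
      rw [hT.sum_outDegree_cons hG hreg hx hy hxy, hsum, hdist hx]
      simp only [dist_self, hf₀]
      push_cast
      linear_combination hz
    · exact key hv'
    · have := congrArg conj (key hu')
      simp only [map_sum, map_mul, map_pow, Complex.conj_conj, Complex.conj_ofReal,
        Complex.conj_natCast] at this
      rw [dist_comm (u := u), ← this]
      exact Finset.sum_congr rfl fun t _ => by ring
    · rw [hT.sum_outDegree_cons hG hreg hx hy hxy, ih hu' hv', dist_comm (u := u) (v := y),
        dist_comm (u := v) (v := y), hdist hu', hdist hv', dist_comm (u := u) (v := x),
        dist_comm (u := v) (v := x)]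
      linear_combination z ^ G.dist x u * conj z ^ G.dist x v * hz

end SimpleGraph

theorem stmt_14 {V : Type*} (d : ℕ) (hd : 3 ≤ d) (lam : ℝ)
    (hlam : |lam| ≤ 2 * Real.sqrt ((d : ℝ) - 1))
    (G : SimpleGraph V) [G.LocallyFinite]
    (hconn : G.Connected) (hacyc : G.IsAcyclic) (hreg : G.IsRegularOfDegree d)
    (m : ℕ) (hm : 1 ≤ m) (v : Fin m → V) (c : Fin m → ℝ) :
    0 ≤ ∑ i : Fin m, ∑ j : Fin m, c i * c j * phi d lam (G.dist (v i) (v j)) := by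
  classical
  obtain ⟨z, hz, hphi⟩ := exists_phi_succ hd hlam
  obtain ⟨T, hT, hvT⟩ := hconn.exists_isGrown (Finset.univ.image v)
  have hv (i : Fin m) : v i ∈ T := hvT (Finset.mem_image_of_mem v (Finset.mem_univ i))
  have hgram : (d : ℝ) * ∑ i, ∑ j, c i * c j * phi d lam (G.dist (v i) (v j)) =
      ∑ t ∈ T, (G.outDegree T t : ℝ) *
        Complex.normSq (∑ i, (c i : ℂ) * z ^ G.dist (v i) t) := by
    apply Complex.ofReal_injective
    push_cast
    simp only [← Complex.mul_conj, map_sum, map_mul, map_pow, Complex.conj_ofReal,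
      Finset.sum_mul_sum]
    simp only [Finset.mul_sum]
    rw [Finset.sum_comm]
    refine Eq.trans ?_ (Finset.sum_comm.trans (Finset.sum_congr rfl fun j _ => Finset.sum_comm)).symm
    rw [Finset.sum_comm]
    refine Finset.sum_congr rfl fun i _ => Finset.sum_congr rfl fun j _ => ?_
    rw [mul_left_comm, ← hT.sum_outDegree_mul_pow_dist hacyc hreg hz (phi_zero hd lam) hphi
      (hv i) (hv j), Finset.mul_sum]
    exact Finset.sum_congr rfl fun t _ => by ring
  have hpos : (0 : ℝ) < d := by positivity
  refine nonneg_of_mul_nonneg_right ?_ hpos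
  rw [hgram]
  exact Finset.sum_nonneg fun t _ => mul_nonneg (Nat.cast_nonneg _) (Complex.normSq_nonneg _)
end
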